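/- Orthogonality properties of the scheme iterates: for all m ∈ {0,…,N} and n ∈ {1,…,N} one has (u^m_h, ∇_h pⁿ_h) = 0, and for all m ∈ {2,…,N} one has |u^m_h|² − |ũ^m_h|² + |u^m_h − ũ^m_h|² = 0, where (·,·) and |·| are the L²(Ω) inner product and norm. -/

import Mathlib

open scoped RealInnerProductSpace
open MeasureTheory

attribute [local instance] Classical.propDecidable

noncomputable section

/-- The Euclidean plane. -/
abbrev E2 : Type := EuclideanSpace ℝ (Fin 2)

/-- A nondegenerate (closed) triangle of the plane, given by its three
affinely independent vertices. -/
structure Tri : Type where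
  vtx : Fin 3 → E2
  indep : AffineIndependent ℝ vtx

namespace Tri

/-- The triangle as a subset of the plane: the convex hull of its vertices. -/
def carrier (t : Tri) : Set E2 := convexHull ℝ (Set.range t.vtx)

/-- The area `|K|` of the triangle. -/
def area (t : Tri) : ℝ := (volume t.carrier).toReal

/-- The centroid of the triangle. -/
def centroid (t : Tri) : E2 := Finset.centroid ℝ Finset.univ t.vtx

/-- The triangle seen as a 2-simplex. -/
def simplex (t : Tri) : Affine.Simplex ℝ E2 2 := ⟨t.vtx, t.indep⟩

/-- The circumcenter `x_K` of the triangle. -/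
def ccenter (t : Tri) : E2 := t.simplex.circumcenter

/-- `σ` (an ordered pair of distinct points) is an edge of the triangle `t`:
both of its endpoints are vertices of `t`. -/
def hasEdge (t : Tri) (σ : E2 × E2) : Prop :=
  σ.1 ≠ σ.2 ∧ σ.1 ∈ Set.range t.vtx ∧ σ.2 ∈ Set.range t.vtx

end Tri

/-- The segment of an edge. -/
def eseg (σ : E2 × E2) : Set E2 := segment ℝ σ.1 σ.2

/-- The length `|σ|` of an edge. -/
def elen (σ : E2 × E2) : ℝ := dist σ.1 σ.2

/-- The midpoint `x_σ` of an edge. -/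
def emid (σ : E2 × E2) : E2 := midpoint ℝ σ.1 σ.2

/-- Rotation by `π/2` in the plane. -/
def perp (x : E2) : E2 := (EuclideanSpace.equiv (Fin 2) ℝ).symm ![-(x 1), x 0]

/-- The unit normal `n_{K,σ}` to the edge `σ`, pointing outward of the triangle `t`. -/
def Tri.nrm (t : Tri) (σ : E2 × E2) : E2 :=
  if 0 ≤ ⟪perp (σ.2 - σ.1), emid σ - t.centroid⟫
  then (elen σ)⁻¹ • perp (σ.2 - σ.1)
  else -((elen σ)⁻¹ • perp (σ.2 - σ.1))

/-- An admissible triangulation `𝒯_h` of `Ω`, together with a registration of its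
edges (each geometric edge is recorded once, with a chosen orientation) and a labelling
`K_σ`, `L_σ` of the triangle(s) adjacent to each edge.  All interior angles of all
triangles are `< π/2`. -/
structure Mesh (Ω : Set E2) : Type where
  tris : Finset Tri
  tris_nonempty : tris.Nonempty
  edges : Finset (E2 × E2)
  Kof : E2 × E2 → Tri
  Lof : E2 × E2 → Tri
  interior_disjoint : ∀ t₁ ∈ tris, ∀ t₂ ∈ tris, t₁ ≠ t₂ →
    interior t₁.carrier ∩ interior t₂.carrier = ∅
  union_eq : ⋃ t ∈ (tris : Set Tri), t.carrier = closure Ω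
  inter_structure : ∀ t₁ ∈ tris, ∀ t₂ ∈ tris, t₁ ≠ t₂ →
    t₁.carrier ∩ t₂.carrier = ∅
    ∨ (∃ a ∈ Set.range t₁.vtx ∩ Set.range t₂.vtx, t₁.carrier ∩ t₂.carrier = {a})
    ∨ (∃ σ, t₁.hasEdge σ ∧ t₂.hasEdge σ ∧ t₁.carrier ∩ t₂.carrier = eseg σ)
  angles_lt : ∀ t ∈ tris, ∀ i j l : Fin 3, i ≠ j → i ≠ l → j ≠ l →
    EuclideanGeometry.angle (t.vtx j) (t.vtx i) (t.vtx l) < Real.pi / 2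
  edges_ne : ∀ σ ∈ edges, σ.1 ≠ σ.2
  edges_cover : ∀ t ∈ tris, ∀ i j : Fin 3, i ≠ j →
    (t.vtx i, t.vtx j) ∈ edges ∨ (t.vtx j, t.vtx i) ∈ edges
  edges_sub : ∀ σ ∈ edges, ∃ t ∈ tris, t.hasEdge σ
  edges_orient : ∀ σ ∈ edges, Prod.swap σ ∉ edges
  edges_atMostTwo : ∀ σ ∈ edges, (tris.filter fun t => t.hasEdge σ).card ≤ 2
  Kof_mem : ∀ σ ∈ edges, Kof σ ∈ tris ∧ (Kof σ).hasEdge σ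
  Lof_mem : ∀ σ ∈ edges, (tris.filter fun t => t.hasEdge σ).card = 2 →
    Lof σ ∈ tris ∧ (Lof σ).hasEdge σ ∧ Lof σ ≠ Kof σ
  ext_frontier : ∀ σ ∈ edges, (tris.filter fun t => t.hasEdge σ).card = 1 →
    eseg σ ⊆ frontier Ω

namespace Mesh

variable {Ω : Set E2} (M : Mesh Ω)

/-- The interior edges `ℰ_h^int` (shared by exactly two triangles). -/
def intEdges : Finset (E2 × E2) :=
  M.edges.filter fun σ => (M.tris.filter fun t => t.hasEdge σ).card = 2

/-- The boundary edges `ℰ_h^ext`. -/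
def extEdges : Finset (E2 × E2) :=
  M.edges.filter fun σ => (M.tris.filter fun t => t.hasEdge σ).card = 1

/-- `d_σ`: distance between the circumcenters of the two triangles sharing `σ`
(interior edges), or from the circumcenter of `K_σ` to the midpoint of `σ`
(boundary edges). -/
def dOf (σ : E2 × E2) : ℝ :=
  if (M.tris.filter fun t => t.hasEdge σ).card = 2
  then dist (M.Kof σ).ccenter (M.Lof σ).ccenter
  else dist (M.Kof σ).ccenter (emid σ)

/-- `τ_σ = |σ| / d_σ`. -/
def tau (σ : E2 × E2) : ℝ := elen σ / M.dOf σ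

/-- The mesh size `h`: the largest diameter of a circumscribed circle. -/
def meshSize : ℝ := M.tris.sup' M.tris_nonempty fun t => 2 * t.simplex.circumradius

/-- Mesh regularity with constant `C_reg`: `d_σ ≥ C_reg |σ|` and `|σ| ≥ C_reg h`. -/
def Regular (Creg : ℝ) : Prop :=
  ∀ σ ∈ M.edges, Creg * elen σ ≤ M.dOf σ ∧ Creg * M.meshSize ≤ elen σ

/-- For `σ` an edge of `t`, the triangle on the other side of `σ`. -/
def other (t : Tri) (σ : E2 × E2) : Tri := if M.Kof σ = t then M.Lof σ else M.Kof σ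

/-- The `L²(Ω)` inner product of two piecewise constant (`P₀`) fields. -/
def l2P0 (v w : Tri → E2) : ℝ := ∑ t ∈ M.tris, t.area * ⟪v t, w t⟫

/-- The `L²(Ω)` norm of a `P₀` field. -/
def l2normP0 (v : Tri → E2) : ℝ := Real.sqrt (M.l2P0 v v)

/-- The discrete `H¹` norm `‖·‖_h` on `P₀`. -/
def normh (v : Tri → E2) : ℝ :=
  Real.sqrt (∑ σ ∈ M.intEdges, M.tau σ * ‖v (M.Lof σ) - v (M.Kof σ)‖ ^ 2
    + ∑ σ ∈ M.extEdges, M.tau σ * ‖v (M.Kof σ)‖ ^ 2)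

/-- A family of affine maps (one per triangle) is in `P₁^{nc}`: the two traces agree
at the midpoint of every interior edge. -/
def IsP1nc (q : Tri → (E2 →ᵃ[ℝ] ℝ)) : Prop :=
  ∀ σ ∈ M.intEdges, q (M.Kof σ) (emid σ) = q (M.Lof σ) (emid σ)

/-- Membership in `L²₀`: the piecewise affine function has zero mean on `Ω`. -/
def MeanZero (q : Tri → (E2 →ᵃ[ℝ] ℝ)) : Prop :=
  ∑ t ∈ M.tris, ∫ x in t.carrier, q t x = 0

/-- The `L²(Ω)` inner product of two piecewise affine functions. -/
def l2P1 (q r : Tri → (E2 →ᵃ[ℝ] ℝ)) : ℝ :=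
  ∑ t ∈ M.tris, ∫ x in t.carrier, q t x * r t x

/-- The `L²(Ω)` norm of a piecewise affine function. -/
def l2normP1 (q : Tri → (E2 →ᵃ[ℝ] ℝ)) : ℝ := Real.sqrt (M.l2P1 q q)

end Mesh

/-- The gradient (a constant vector) of an affine function on the plane. -/
def gradA (f : E2 →ᵃ[ℝ] ℝ) : E2 :=
  (InnerProductSpace.toDual ℝ E2).symm (LinearMap.toContinuousLinearMap f.linear)

/-- The discrete gradient `∇_h q` of a piecewise affine function: the piecewise
constant field equal on each triangle to the gradient of the affine piece. -/
def gradh (q : Tri → (E2 →ᵃ[ℝ] ℝ)) : Tri → E2 := fun t => gradA (q t)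

/-- The (constant) divergence of an affine vector field of the plane. -/
def divA (f : E2 →ᵃ[ℝ] E2) : ℝ := LinearMap.trace ℝ E2 f.linear

/-- The normal component `(u·n_{K,σ})_σ` of a piecewise affine field on the edge `σ`
of the triangle `t` (evaluated at the midpoint of `σ`). -/
def unrm (u : Tri → (E2 →ᵃ[ℝ] E2)) (t : Tri) (σ : E2 × E2) : ℝ :=
  ⟪u t (emid σ), t.nrm σ⟫

namespace Mesh

variable {Ω : Set E2} (M : Mesh Ω)

/-- The norm `‖q‖_{1,h} = (|q|² + |∇_h q|²)^{1/2}` on `P₁^{nc}`. -/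
def norm1h (q : Tri → (E2 →ᵃ[ℝ] ℝ)) : ℝ :=
  Real.sqrt ((M.l2normP1 q) ^ 2 + (M.l2normP0 (gradh q)) ^ 2)

/-- The prescribed value of `div_h v` at the midpoint of the edge `σ`. -/
def divhImage (v : Tri → E2) (σ : E2 × E2) : ℝ :=
  if (M.tris.filter fun t => t.hasEdge σ).card = 2 then
    (3 * elen σ / ((M.Kof σ).area + (M.Lof σ).area)) *
      ⟪v (M.Lof σ) - v (M.Kof σ), (M.Kof σ).nrm σ⟫
  else
    -((3 * elen σ / (M.Kof σ).area) * ⟪v (M.Kof σ), (M.Kof σ).nrm σ⟫)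

/-- `d = div_h v`: `d` is the element of `P₁^{nc}` taking the prescribed values at
the midpoints of the edges. -/
def IsDivh (v : Tri → E2) (d : Tri → (E2 →ᵃ[ℝ] ℝ)) : Prop :=
  M.IsP1nc d ∧
    ∀ t ∈ M.tris, ∀ σ ∈ M.edges, t.hasEdge σ → d t (emid σ) = M.divhImage v σ

/-- The discrete Laplacian `Δ̃_h` on `P₀`. -/
def laph (v : Tri → E2) : Tri → E2 := fun t =>
  (t.area)⁻¹ •
    ((∑ σ ∈ M.intEdges.filter fun σ => t.hasEdge σ, M.tau σ • (v (M.other t σ) - v t))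
      - ∑ σ ∈ M.extEdges.filter fun σ => t.hasEdge σ, M.tau σ • v t)

/-- The upwind convection operator `b̃_h(u_h, v_h) ∈ P₀`. -/
def btilde (u : Tri → (E2 →ᵃ[ℝ] E2)) (v : Tri → E2) : Tri → E2 := fun t =>
  (t.area)⁻¹ • ∑ σ ∈ M.intEdges.filter fun σ => t.hasEdge σ,
    elen σ • (max (unrm u t σ) 0 • v t + min (unrm u t σ) 0 • v (M.other t σ))

/-- The trilinear form `b_h(u_h, v_h, w_h)`. -/
def bh (u : Tri → (E2 →ᵃ[ℝ] E2)) (v w : Tri → E2) : ℝ :=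
  ∑ t ∈ M.tris, t.area * ⟪w t, M.btilde u v t⟫

/-- Membership in the lowest-order Raviart–Thomas space `RT₀`: the normal component is
constant on each edge of each triangle, matches across interior edges and vanishes on
boundary edges. -/
def IsRT0 (u : Tri → (E2 →ᵃ[ℝ] E2)) : Prop :=
  (∀ t ∈ M.tris, ∀ σ ∈ M.edges, t.hasEdge σ → ∀ x ∈ eseg σ,
      ⟪u t x, t.nrm σ⟫ = unrm u t σ)
  ∧ (∀ σ ∈ M.intEdges,
      ⟪u (M.Kof σ) (emid σ), (M.Kof σ).nrm σ⟫ =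
        ⟪u (M.Lof σ) (emid σ), (M.Kof σ).nrm σ⟫)
  ∧ (∀ σ ∈ M.extEdges, unrm u (M.Kof σ) σ = 0)

/-- Membership of a piecewise constant field in `P₀ ∩ RT₀`. -/
def IsRT0const (v : Tri → E2) : Prop :=
  (∀ σ ∈ M.intEdges, ⟪v (M.Lof σ) - v (M.Kof σ), (M.Kof σ).nrm σ⟫ = 0)
  ∧ ∀ σ ∈ M.extEdges, ⟪v (M.Kof σ), (M.Kof σ).nrm σ⟫ = 0

/-- The `L²(Ω)` norm of a piecewise affine vector field. -/
def l2normRT (u : Tri → (E2 →ᵃ[ℝ] E2)) : ℝ :=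
  Real.sqrt (∑ t ∈ M.tris, ∫ x in t.carrier, ‖u t x‖ ^ 2)

end Mesh

/-- The projection scheme of the paper: the BDF2 momentum step, the pressure projection
step and the velocity correction step, with time step `k = T/N`. -/
structure Scheme {Ω : Set E2} (M : Mesh Ω) : Type where
  Re : ℝ
  T : ℝ
  N : ℕ
  hRe : 0 < Re
  hT : 0 < T
  hN : 2 ≤ N
  k : ℝ
  hk : k = T / N
  fh : ℕ → Tri → E2
  u : ℕ → Tri → E2
  ut : ℕ → Tri → E2
  p : ℕ → Tri → (E2 →ᵃ[ℝ] ℝ)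
  hu0 : M.IsRT0const (u 0)
  hu1 : M.IsRT0const (u 1)
  hp : ∀ n, 1 ≤ n → n ≤ N → M.IsP1nc (p n) ∧ M.MeanZero (p n)
  mom : ∀ n, 1 ≤ n → n + 1 ≤ N → ∀ t ∈ M.tris,
    (2 * k)⁻¹ • ((3 : ℝ) • ut (n+1) t - (4 : ℝ) • u n t + u (n-1) t)
      - Re⁻¹ • M.laph (ut (n+1)) t
      + M.btilde (fun s => AffineMap.const ℝ E2 ((2 : ℝ) • u n s - u (n-1) s)) (ut (n+1)) t
      + gradh (p n) t
      = fh (n+1) t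
  proj : ∀ n, 1 ≤ n → n + 1 ≤ N → ∀ σ ∈ M.edges,
    M.divhImage (fun s => gradA (p (n+1) s - p n s)) σ =
      (3 / (2 * k)) * M.divhImage (ut (n+1)) σ
  corr : ∀ n, 1 ≤ n → n + 1 ≤ N → ∀ t ∈ M.tris,
    u (n+1) t = ut (n+1) t - (2 * k / 3) • gradA (p (n+1) t - p n t)

/-- The planar cross product. -/
def cr (x y : E2) : ℝ := x 0 * y 1 - x 1 * y 0

lemma inner_coord (x y : E2) : ⟪x, y⟫ = x 0 * y 0 + x 1 * y 1 := by
  simp [PiLp.inner_apply, Fin.sum_univ_two, mul_comm]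

lemma perp_zero (x : E2) : perp x 0 = -(x 1) := rfl
lemma perp_one (x : E2) : perp x 1 = x 0 := rfl

lemma inner_perp (x y : E2) : ⟪perp x, y⟫ = cr x y := by
  rw [inner_coord, perp_zero, perp_one, cr]; ring

/-- The affine basis of the plane given by the vertices. -/
def Tri.bas (t : Tri) : AffineBasis (Fin 3) ℝ E2 :=
  ⟨t.vtx, t.indep, by
    rw [t.indep.affineSpan_eq_top_iff_card_eq_finrank_add_one]; simp⟩

lemma Tri.bas_coe (t : Tri) : ⇑t.bas = t.vtx := rfl

lemma sum_ijk {A : Type*} [AddCommMonoid A] (f : Fin 3 → A) {i j k : Fin 3}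
    (hij : i ≠ j) (hik : i ≠ k) (hjk : j ≠ k) : ∑ l, f l = f i + f j + f k := by
  have : (Finset.univ : Finset (Fin 3)) = {i, j, k} := by
    revert i j k; decide
  rw [this, Finset.sum_insert (by simp [hij, hik]), Finset.sum_pair hjk, add_assoc]

lemma Tri.cr_coord (t : Tri) {i j k : Fin 3}
    (hij : i ≠ j) (hik : i ≠ k) (hjk : j ≠ k) (y : E2) :
    cr (t.vtx j - t.vtx i) (y - t.vtx i)
      = t.bas.coord k y * cr (t.vtx j - t.vtx i) (t.vtx k - t.vtx i) := by
  have h1 := t.bas.linear_combination_coord_eq_self y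
  have h2 := t.bas.sum_coord_apply_eq_one y
  rw [sum_ijk _ hij hik hjk, Tri.bas_coe] at h1
  rw [sum_ijk _ hij hik hjk] at h2
  have h0 := congrArg (fun z : E2 => z 0) h1
  have h3 := congrArg (fun z : E2 => z 1) h1
  simp only [PiLp.add_apply, PiLp.smul_apply, smul_eq_mul] at h0 h3
  simp only [cr, PiLp.sub_apply]
  rw [← h0, ← h3]
  have : t.bas.coord i y = 1 - t.bas.coord j y - t.bas.coord k y := by linarith
  rw [this]; ring

lemma Tri.cr_ne (t : Tri) {i j k : Fin 3}
    (hij : i ≠ j) (hik : i ≠ k) (hjk : j ≠ k) :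
    cr (t.vtx j - t.vtx i) (t.vtx k - t.vtx i) ≠ 0 := by
  intro h
  have := t.cr_coord hij hik hjk (t.vtx i + perp (t.vtx j - t.vtx i))
  rw [h, mul_zero, add_sub_cancel_left, ← inner_perp] at this
  rw [inner_self_eq_zero] at this
  have h0 := congrArg (fun z : E2 => z 0) this
  have h1 := congrArg (fun z : E2 => z 1) this
  simp only [perp_zero, perp_one] at h0 h1
  apply hij
  apply t.indep.injective
  ext l
  fin_cases l
  · simp at h1 ⊢; linarith
  · simp at h0 ⊢; linarith

open Filter Topology in
lemma Tri.eventually_interior (t : Tri) {i j k : Fin 3}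
    (hij : i ≠ j) (hik : i ≠ k) (hjk : j ≠ k) (y : E2)
    (hy : 0 < cr (t.vtx j - t.vtx i) (y - t.vtx i) *
      cr (t.vtx j - t.vtx i) (t.vtx k - t.vtx i)) :
    ∀ᶠ ε : ℝ in 𝓝[>] 0,
      AffineMap.lineMap (midpoint ℝ (t.vtx i) (t.vtx j)) y ε ∈ interior t.carrier := by
  have hk : 0 < t.bas.coord k y := by
    rw [t.cr_coord hij hik hjk, mul_assoc] at hy
    exact pos_of_mul_pos_left hy (mul_self_nonneg _)
  have key : ∀ l, ∀ᶠ ε : ℝ in 𝓝[>] 0, 0 < t.bas.coord l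
      (AffineMap.lineMap (midpoint ℝ (t.vtx i) (t.vtx j)) y ε) := by
    have hpos : ∀ l, 0 < t.bas.coord l (midpoint ℝ (t.vtx i) (t.vtx j)) →
        ∀ᶠ ε : ℝ in 𝓝[>] 0, 0 < t.bas.coord l
      (AffineMap.lineMap (midpoint ℝ (t.vtx i) (t.vtx j)) y ε) := by
      intro l hl
      have hc : Continuous fun ε : ℝ => t.bas.coord l
          (AffineMap.lineMap (midpoint ℝ (t.vtx i) (t.vtx j)) y ε) :=
        (continuous_barycentric_coord t.bas l).comp AffineMap.lineMap_continuous
      have : ∀ᶠ ε : ℝ in 𝓝 0, 0 < t.bas.coord l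
          (AffineMap.lineMap (midpoint ℝ (t.vtx i) (t.vtx j)) y ε) := by
        apply hc.continuousAt.eventually_const_lt
        simpa using hl
      exact this.filter_mono nhdsWithin_le_nhds
    have hmid : ∀ l, t.bas.coord l (midpoint ℝ (t.vtx i) (t.vtx j)) =
        midpoint ℝ (t.bas.coord l (t.bas i)) (t.bas.coord l (t.bas j)) := by
      intro l
      rw [AffineMap.map_midpoint]; rfl
    intro l
    have hl : l = i ∨ l = j ∨ l = k := by
      clear hpos hmid hk hy
      revert l i j k; decide
    rcases hl with rfl | rfl | rfl
    · apply hpos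
      rw [hmid, AffineBasis.coord_apply_eq, AffineBasis.coord_apply_ne _ hij]
      norm_num [midpoint_eq_smul_add]
    · apply hpos
      rw [hmid, AffineBasis.coord_apply_eq, AffineBasis.coord_apply_ne _ hij.symm]
      norm_num [midpoint_eq_smul_add]
    · filter_upwards [self_mem_nhdsWithin] with ε hε
      rw [AffineMap.apply_lineMap, hmid, AffineBasis.coord_apply_ne _ hik.symm,
        AffineBasis.coord_apply_ne _ hjk.symm, midpoint_self, AffineMap.lineMap_apply]
      simpa using mul_pos hε hk
  have hc : t.carrier = convexHull ℝ (Set.range t.bas) := rfl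
  rw [hc, AffineBasis.interior_convexHull]
  exact eventually_all.mpr key

lemma Tri.area_pos (t : Tri) : 0 < t.area := by
  have h1 : (interior t.carrier).Nonempty := ⟨_, t.bas.centroid_mem_interior_convexHull⟩
  have h2 : 0 < volume t.carrier := Measure.measure_pos_of_nonempty_interior _ h1
  have h3 : volume t.carrier < ⊤ := by
    apply Bornology.IsBounded.measure_lt_top
    exact isBounded_convexHull.mpr (Set.finite_range _).isBounded
  exact ENNReal.toReal_pos h2.ne' h3.ne

/-- Volume of the reference triangle. -/
def refVol : ℝ :=
  (volume (convexHull ℝ (Set.range ![(0 : E2), !₂[1, 0], !₂[0, 1]]))).toReal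

/-- The linear part of the map from the reference triangle. -/
def refLin (x y : E2) : E2 →ₗ[ℝ] E2 where
  toFun z := z 0 • x + z 1 • y
  map_add' a b := by simp only [PiLp.add_apply]; module
  map_smul' a b := by simp only [PiLp.smul_apply, RingHom.id_apply, smul_eq_mul]; module

lemma det_refLin (x y : E2) : LinearMap.det (refLin x y) = cr x y := by
  rw [← LinearMap.det_toMatrix (EuclideanSpace.basisFun (Fin 2) ℝ).toBasis, Matrix.det_fin_two]
  simp [LinearMap.toMatrix_apply, refLin, cr]
  ring

open scoped Pointwise in
lemma Tri.area_eq (t : Tri) :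
    t.area = refVol * |cr (t.vtx 1 - t.vtx 0) (t.vtx 2 - t.vtx 0)| := by
  have h : t.carrier = t.vtx 0 +ᵥ (refLin (t.vtx 1 - t.vtx 0) (t.vtx 2 - t.vtx 0) ''
      (convexHull ℝ (Set.range ![(0 : E2), !₂[1, 0], !₂[0, 1]]))) := by
    rw [LinearMap.image_convexHull, ← convexHull_vadd, Tri.carrier, ← Set.range_comp]
    congr 1
    ext z
    simp only [Set.mem_range, Set.mem_vadd_set, Function.comp]
    constructor
    · rintro ⟨i, rfl⟩
      refine ⟨_, ⟨i, rfl⟩, ?_⟩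
      fin_cases i <;> simp [refLin]
    · rintro ⟨_, ⟨i, rfl⟩, rfl⟩
      refine ⟨i, ?_⟩
      fin_cases i <;> simp [refLin]
  rw [Tri.area, h, measure_vadd, Measure.addHaar_image_linearMap, det_refLin, refVol,
    ENNReal.toReal_mul, ENNReal.toReal_ofReal (abs_nonneg _), mul_comm]

lemma Tri.exists_idx {t : Tri} {σ : E2 × E2} (h : t.hasEdge σ) :
    ∃ i j k : Fin 3, i ≠ j ∧ i ≠ k ∧ j ≠ k ∧ σ = (t.vtx i, t.vtx j) := by
  obtain ⟨h0, ⟨i, hi⟩, ⟨j, hj⟩⟩ := h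
  have hij : i ≠ j := by
    rintro rfl
    exact h0 (hi.symm.trans hj)
  have : ∀ i j : Fin 3, i ≠ j → ∃ k, i ≠ k ∧ j ≠ k := by decide
  obtain ⟨k, hk, hk'⟩ := this i j hij
  exact ⟨i, j, k, hij, hk, hk', by rw [hi, hj]⟩

lemma Tri.centroid_coord (t : Tri) {i j k : Fin 3}
    (hij : i ≠ j) (hik : i ≠ k) (hjk : j ≠ k) (l : Fin 2) :
    t.centroid l = (t.vtx i l + t.vtx j l + t.vtx k l) / 3 := by
  have hw : ∑ i, Finset.centroidWeights ℝ (Finset.univ : Finset (Fin 3)) i = 1 :=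
    Finset.sum_centroidWeights_eq_one_of_nonempty ℝ _ ⟨0, Finset.mem_univ _⟩
  rw [Tri.centroid, Finset.centroid_def,
    Finset.affineCombination_eq_linear_combination _ _ _ hw, sum_ijk _ hij hik hjk]
  simp [Finset.centroidWeights_apply]
  ring

lemma emid_coord (a b : E2) (l : Fin 2) : emid (a, b) l = (a l + b l) / 2 := by
  simp [emid, midpoint_eq_smul_add]
  ring

lemma Tri.nrm_eq (t : Tri) {i j k : Fin 3}
    (hij : i ≠ j) (hik : i ≠ k) (hjk : j ≠ k) :
    elen (t.vtx i, t.vtx j) • t.nrm (t.vtx i, t.vtx j) =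
      -(SignType.sign (cr (t.vtx j - t.vtx i) (t.vtx k - t.vtx i)) : ℝ) •
        perp (t.vtx j - t.vtx i) := by
  have hD := t.cr_ne hij hik hjk
  have hin : ⟪perp (t.vtx j - t.vtx i), emid (t.vtx i, t.vtx j) - t.centroid⟫ =
      -(1 / 3) * cr (t.vtx j - t.vtx i) (t.vtx k - t.vtx i) := by
    rw [inner_perp]
    simp only [cr, PiLp.sub_apply, emid_coord, t.centroid_coord hij hik hjk]
    ring
  have hl : elen (t.vtx i, t.vtx j) ≠ 0 :=
    dist_ne_zero.mpr (fun h => hij (t.indep.injective h))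
  rw [Tri.nrm]
  simp only [hin]
  rcases lt_or_gt_of_ne hD with h | h
  · rw [if_pos (by linarith), smul_inv_smul₀ hl, sign_neg h]
    simp
  · rw [if_neg (by linarith), smul_neg, smul_inv_smul₀ hl, sign_pos h]
    simp

lemma cr_swap (a b c : E2) : cr (a - b) (c - b) = -cr (b - a) (c - a) := by
  simp only [cr, PiLp.sub_apply]; ring

lemma perp_swap (a b : E2) : perp (a - b) = -perp (b - a) := by
  ext l; fin_cases l
  · simp [perp]
  · simp [perp]

lemma Tri.nrm_swap (t : Tri) {i j k : Fin 3}
    (hij : i ≠ j) (hik : i ≠ k) (hjk : j ≠ k) :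
    elen (t.vtx j, t.vtx i) • t.nrm (t.vtx j, t.vtx i) =
      elen (t.vtx i, t.vtx j) • t.nrm (t.vtx i, t.vtx j) := by
  rw [t.nrm_eq hij hik hjk, t.nrm_eq hij.symm hjk hik, cr_swap, perp_swap, Left.sign_neg]
  simp

lemma affine_eq (f : E2 →ᵃ[ℝ] ℝ) (x : E2) : f x = f 0 + ⟪gradA f, x⟫ := by
  have h : ⟪gradA f, x⟫ = f.linear x := by
    simp [gradA]
  rw [h, add_comm]
  simpa using f.map_vadd 0 x

/-- Flux of `v` through the edge, weighted by the midpoint value of `f`. -/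
def flux (t : Tri) (v : E2) (f : E2 →ᵃ[ℝ] ℝ) (σ : E2 × E2) : ℝ :=
  ⟪v, elen σ • t.nrm σ⟫ * f (emid σ)

lemma flux_swap (t : Tri) (v : E2) (f : E2 →ᵃ[ℝ] ℝ) {i j : Fin 3} (hij : i ≠ j) :
    flux t v f (t.vtx j, t.vtx i) = flux t v f (t.vtx i, t.vtx j) := by
  have : ∀ i j : Fin 3, i ≠ j → ∃ k, i ≠ k ∧ j ≠ k := by decide
  obtain ⟨k, hk, hk'⟩ := this i j hij
  rw [flux, flux, t.nrm_swap hij hk hk', emid, emid, midpoint_comm]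

lemma green_tri (t : Tri) (v : E2) (f : E2 →ᵃ[ℝ] ℝ) :
    t.area * ⟪v, gradA f⟫ = 2 * refVol *
      (flux t v f (t.vtx 0, t.vtx 1) + flux t v f (t.vtx 1, t.vtx 2)
        + flux t v f (t.vtx 2, t.vtx 0)) := by
  have e1 : cr (t.vtx 2 - t.vtx 1) (t.vtx 0 - t.vtx 1) =
      cr (t.vtx 1 - t.vtx 0) (t.vtx 2 - t.vtx 0) := by
    simp only [cr, PiLp.sub_apply]; ring
  have e2 : cr (t.vtx 0 - t.vtx 2) (t.vtx 1 - t.vtx 2) =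
      cr (t.vtx 1 - t.vtx 0) (t.vtx 2 - t.vtx 0) := by
    simp only [cr, PiLp.sub_apply]; ring
  rw [flux, flux, flux,
    t.nrm_eq (i := 0) (j := 1) (k := 2) (by decide) (by decide) (by decide),
    t.nrm_eq (i := 1) (j := 2) (k := 0) (by decide) (by decide) (by decide),
    t.nrm_eq (i := 2) (j := 0) (k := 1) (by decide) (by decide) (by decide),
    e1, e2, t.area_eq, ← sign_mul_self (cr (t.vtx 1 - t.vtx 0) (t.vtx 2 - t.vtx 0)),
    affine_eq f (emid (t.vtx 0, t.vtx 1)), affine_eq f (emid (t.vtx 1, t.vtx 2)),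
    affine_eq f (emid (t.vtx 2, t.vtx 0))]
  generalize (SignType.sign (cr (t.vtx 1 - t.vtx 0) (t.vtx 2 - t.vtx 0)) : ℝ) = s
  generalize gradA f = g
  simp only [inner_coord, PiLp.smul_apply, perp_zero, perp_one, smul_eq_mul, emid_coord, cr,
    PiLp.sub_apply]
  ring

namespace Mesh

variable {Ω : Set E2} (M : Mesh Ω)

lemma nrm_opp {t₁ t₂ : Tri} (h₁ : t₁ ∈ M.tris) (h₂ : t₂ ∈ M.tris) (hne : t₁ ≠ t₂)
    {σ : E2 × E2} (e₁ : t₁.hasEdge σ) (e₂ : t₂.hasEdge σ) :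
    elen σ • t₂.nrm σ = -(elen σ • t₁.nrm σ) := by
  obtain ⟨i, j, k, hij, hik, hjk, rfl⟩ := Tri.exists_idx e₁
  obtain ⟨i', j', k', hij', hik', hjk', hσ⟩ := Tri.exists_idx e₂
  have hi : t₁.vtx i = t₂.vtx i' := congrArg Prod.fst hσ
  have hj : t₁.vtx j = t₂.vtx j' := congrArg Prod.snd hσ
  have hD₁ := t₁.cr_ne hij hik hjk
  have hD₂ := t₂.cr_ne hij' hik' hjk'
  have hneg : cr (t₁.vtx j - t₁.vtx i) (t₁.vtx k - t₁.vtx i) *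
      cr (t₂.vtx j' - t₂.vtx i') (t₂.vtx k' - t₂.vtx i') < 0 := by
    by_contra hcon
    have hpos := lt_of_le_of_ne (not_lt.mp hcon) (mul_ne_zero hD₁ hD₂).symm
    have a₁ := t₁.eventually_interior hij hik hjk (t₁.vtx k) (mul_self_pos.mpr hD₁)
    have a₂ := t₂.eventually_interior hij' hik' hjk' (t₁.vtx k) (by rwa [← hi, ← hj] at hpos ⊢)
    rw [← hi, ← hj] at a₂
    obtain ⟨ε, b₁, b₂⟩ := (a₁.and a₂).exists
    have := M.interior_disjoint t₁ h₁ t₂ h₂ hne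
    exact (Set.eq_empty_iff_forall_notMem.mp this _) ⟨b₁, b₂⟩
  rw [t₁.nrm_eq hij hik hjk, hσ, t₂.nrm_eq hij' hik' hjk', hi, hj]
  rw [hi, hj] at hneg
  rcases mul_neg_iff.mp hneg with ⟨p, q⟩ | ⟨p, q⟩
  · rw [sign_pos p, sign_neg q]; simp
  · rw [sign_neg p, sign_pos q]; simp

lemma sum_edges {t : Tri} (ht : t ∈ M.tris) (F : E2 × E2 → ℝ)
    (hF : ∀ i j, i ≠ j → F (t.vtx j, t.vtx i) = F (t.vtx i, t.vtx j)) :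
    ∑ σ ∈ M.edges.filter (fun σ => t.hasEdge σ), F σ =
      F (t.vtx 0, t.vtx 1) + F (t.vtx 1, t.vtx 2) + F (t.vtx 2, t.vtx 0) := by
  have inj := t.indep.injective
  have hex : ∀ i j, i ≠ j → ∃ e ∈ M.edges, F e = F (t.vtx i, t.vtx j) ∧
      (e = (t.vtx i, t.vtx j) ∨ e = (t.vtx j, t.vtx i)) := by
    intro i j hij
    rcases M.edges_cover t ht i j hij with h | h
    · exact ⟨_, h, rfl, Or.inl rfl⟩
    · exact ⟨_, h, hF i j hij, Or.inr rfl⟩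
  obtain ⟨e0, m0, f0, c0⟩ := hex 0 1 (by decide)
  obtain ⟨e1, m1, f1, c1⟩ := hex 1 2 (by decide)
  obtain ⟨e2, m2, f2, c2⟩ := hex 2 0 (by decide)
  have n01 : t.vtx 0 ≠ t.vtx 1 := inj.ne (by decide)
  have n12 : t.vtx 1 ≠ t.vtx 2 := inj.ne (by decide)
  have n02 : t.vtx 0 ≠ t.vtx 2 := inj.ne (by decide)
  have d01 : e0 ≠ e1 := by
    rcases c0 with rfl | rfl <;> rcases c1 with rfl | rfl <;> simp [n01, n12, n02, n02.symm, n01.symm, n12.symm]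
  have d12 : e1 ≠ e2 := by
    rcases c1 with rfl | rfl <;> rcases c2 with rfl | rfl <;> simp [n01, n12, n02, n02.symm, n01.symm, n12.symm]
  have d02 : e0 ≠ e2 := by
    rcases c0 with rfl | rfl <;> rcases c2 with rfl | rfl <;> simp [n01, n12, n02, n02.symm, n01.symm, n12.symm]
  have hedge : ∀ i j, i ≠ j → t.hasEdge (t.vtx i, t.vtx j) := fun i j h =>
    ⟨inj.ne h, ⟨i, rfl⟩, ⟨j, rfl⟩⟩
  have huniq : ∀ σ ∈ M.edges, ∀ e ∈ M.edges, ∀ a b : E2, (σ = (a, b) ∨ σ = (b, a)) →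
      (e = (a, b) ∨ e = (b, a)) → σ = e := by
    intro σ hσ e he a b h h'
    have := M.edges_orient σ hσ
    rcases h with rfl | rfl <;> rcases h' with rfl | rfl
    · rfl
    · exact absurd he this
    · exact absurd he this
    · rfl
  have hset : M.edges.filter (fun σ => t.hasEdge σ) = {e0, e1, e2} := by
    ext σ
    simp only [Finset.mem_filter, Finset.mem_insert, Finset.mem_singleton]
    constructor
    · rintro ⟨hσ, h⟩
      obtain ⟨i, j, k, hij, -, -, hs⟩ := Tri.exists_idx h
      have hcase : ∀ i j : Fin 3, i ≠ j → (i = 0 ∧ j = 1 ∨ i = 1 ∧ j = 0) ∨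
        (i = 1 ∧ j = 2 ∨ i = 2 ∧ j = 1) ∨ (i = 2 ∧ j = 0 ∨ i = 0 ∧ j = 2) := by decide
      rcases hcase i j hij with h | h | h
      · left
        refine huniq σ hσ e0 m0 _ _ ?_ c0
        rcases h with ⟨rfl, rfl⟩ | ⟨rfl, rfl⟩ <;> simp [hs]
      · right; left
        refine huniq σ hσ e1 m1 _ _ ?_ c1
        rcases h with ⟨rfl, rfl⟩ | ⟨rfl, rfl⟩ <;> simp [hs]
      · right; right
        refine huniq σ hσ e2 m2 _ _ ?_ c2
        rcases h with ⟨rfl, rfl⟩ | ⟨rfl, rfl⟩ <;> simp [hs]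
    · rintro (rfl | rfl | rfl)
      · exact ⟨m0, by rcases c0 with rfl | rfl <;> exact hedge _ _ (by decide)⟩
      · exact ⟨m1, by rcases c1 with rfl | rfl <;> exact hedge _ _ (by decide)⟩
      · exact ⟨m2, by rcases c2 with rfl | rfl <;> exact hedge _ _ (by decide)⟩
  rw [hset, Finset.sum_insert (by simp [d01, d02]), Finset.sum_pair d12, f0, f1, f2, add_assoc]

lemma card_cases {σ : E2 × E2} (hσ : σ ∈ M.edges) :
    (M.tris.filter fun t => t.hasEdge σ).card = 2 ∨
      (M.tris.filter fun t => t.hasEdge σ).card = 1 := by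
  have h1 := M.edges_atMostTwo σ hσ
  have h2 : 0 < (M.tris.filter fun t => t.hasEdge σ).card :=
    Finset.card_pos.mpr ⟨M.Kof σ, Finset.mem_filter.mpr (M.Kof_mem σ hσ)⟩
  omega

/-- Discrete Green formula. -/
lemma green (v : Tri → E2) (q : Tri → (E2 →ᵃ[ℝ] ℝ)) (hv : M.IsRT0const v) (hq : M.IsP1nc q) :
    M.l2P0 v (gradh q) = 0 := by
  have h1 : M.l2P0 v (gradh q) = 2 * refVol *
      ∑ t ∈ M.tris, ∑ σ ∈ M.edges.filter (fun σ => t.hasEdge σ), flux t (v t) (q t) σ := by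
    rw [l2P0, Finset.mul_sum]
    refine Finset.sum_congr rfl fun t ht => ?_
    rw [M.sum_edges ht _ (fun i j hij => flux_swap t _ _ hij), gradh, green_tri]
  have h2 : ∑ t ∈ M.tris, ∑ σ ∈ M.edges.filter (fun σ => t.hasEdge σ), flux t (v t) (q t) σ =
      ∑ σ ∈ M.edges, ∑ t ∈ M.tris.filter (fun t => t.hasEdge σ), flux t (v t) (q t) σ := by
    simp only [Finset.sum_filter]
    exact Finset.sum_comm
  rw [h1, h2, Finset.sum_eq_zero, mul_zero]
  intro σ hσ
  have hK := M.Kof_mem σ hσ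
  rcases M.card_cases hσ with hc | hc
  · have hint : σ ∈ M.intEdges := Finset.mem_filter.mpr ⟨hσ, hc⟩
    obtain ⟨hL, hLe, hne⟩ := M.Lof_mem σ hσ hc
    have hset : M.tris.filter (fun t => t.hasEdge σ) = {M.Kof σ, M.Lof σ} := by
      symm
      apply Finset.eq_of_subset_of_card_le
      · intro t ht
        rcases Finset.mem_insert.mp ht with rfl | ht
        · exact Finset.mem_filter.mpr hK
        · rw [Finset.mem_singleton.mp ht]
          exact Finset.mem_filter.mpr ⟨hL, hLe⟩
      · rw [hc, Finset.card_pair hne.symm]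
    rw [hset, Finset.sum_pair hne.symm, flux, flux, M.nrm_opp hK.1 hL hne.symm hK.2 hLe,
      hq σ hint, ← add_mul]
    have := hv.1 σ hint
    rw [inner_sub_left] at this
    rw [inner_neg_right, real_inner_smul_right, real_inner_smul_right,
      sub_eq_zero.mp this]
    ring
  · have hext : σ ∈ M.extEdges := Finset.mem_filter.mpr ⟨hσ, hc⟩
    have hset : M.tris.filter (fun t => t.hasEdge σ) = {M.Kof σ} := by
      symm
      apply Finset.eq_of_subset_of_card_le
      · intro t ht
        rw [Finset.mem_singleton.mp ht]
        exact Finset.mem_filter.mpr hK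
      · rw [hc, Finset.card_singleton]
    rw [hset, Finset.sum_singleton, flux, real_inner_smul_right, hv.2 σ hext]
    ring

lemma l2normP0_sq (v : Tri → E2) : (M.l2normP0 v) ^ 2 = M.l2P0 v v :=
  Real.sq_sqrt (Finset.sum_nonneg fun t _ => mul_nonneg t.area_pos.le real_inner_self_nonneg)

end Mesh

lemma gradA_sub (f g : E2 →ᵃ[ℝ] ℝ) : gradA (f - g) = gradA f - gradA g := by
  simp [gradA]

namespace Scheme

variable {Ω : Set E2} {M : Mesh Ω} (S : Scheme M)

lemma k_pos : 0 < S.k := by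
  have h1 := S.hT
  have h2 := S.hN
  rw [S.hk]
  exact div_pos h1 (by exact_mod_cast (by omega : 0 < S.N))

lemma u_RT0 (m : ℕ) (hm : m ≤ S.N) : M.IsRT0const (S.u m) := by
  rcases m with _ | _ | n
  · exact S.hu0
  · exact S.hu1
  have hk := S.k_pos
  have hproj := S.proj (n + 1) (by omega) hm
  have hcorr := S.corr (n + 1) (by omega) hm
  set w : Tri → E2 := fun s => gradA (S.p (n + 1 + 1) s - S.p (n + 1) s) with hw
  constructor
  · intro σ hσ
    obtain ⟨he, hc⟩ := Finset.mem_filter.mp hσ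
    have hK := M.Kof_mem σ he
    obtain ⟨hL, hLe, hne⟩ := M.Lof_mem σ he hc
    have hp := hproj σ he
    rw [Mesh.divhImage, Mesh.divhImage, if_pos hc, if_pos hc] at hp
    have hl : 0 < elen σ := dist_pos.mpr (M.edges_ne σ he)
    have hco : 3 * elen σ / ((M.Kof σ).area + (M.Lof σ).area) ≠ 0 := by
      have := (M.Kof σ).area_pos
      have := (M.Lof σ).area_pos
      positivity
    have hp2 : ⟪w (M.Lof σ) - w (M.Kof σ), (M.Kof σ).nrm σ⟫ = 3 / (2 * S.k) *
        ⟪S.ut (n + 1 + 1) (M.Lof σ) - S.ut (n + 1 + 1) (M.Kof σ), (M.Kof σ).nrm σ⟫ := by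
      apply mul_left_cancel₀ hco
      rw [hp]; ring
    rw [hcorr _ hK.1, hcorr _ hL]
    change ⟪(_ - _ • w (M.Lof σ)) - (_ - _ • w (M.Kof σ)), _⟫ = 0
    simp only [inner_sub_left, real_inner_smul_left] at hp2 ⊢
    field_simp at hp2 ⊢
    linarith
  · intro σ hσ
    obtain ⟨he, hc⟩ := Finset.mem_filter.mp hσ
    have hK := M.Kof_mem σ he
    have hp := hproj σ he
    rw [Mesh.divhImage, Mesh.divhImage, if_neg (by omega), if_neg (by omega)] at hp
    have hl : 0 < elen σ := dist_pos.mpr (M.edges_ne σ he)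
    have hco : 3 * elen σ / (M.Kof σ).area ≠ 0 := by
      have := (M.Kof σ).area_pos
      positivity
    have hp2 : ⟪w (M.Kof σ), (M.Kof σ).nrm σ⟫ = 3 / (2 * S.k) *
        ⟪S.ut (n + 1 + 1) (M.Kof σ), (M.Kof σ).nrm σ⟫ := by
      apply mul_left_cancel₀ hco
      linear_combination -hp
    rw [hcorr _ hK.1]
    change ⟪_ - _ • w (M.Kof σ), _⟫ = 0
    simp only [inner_sub_left, real_inner_smul_left] at hp2 ⊢
    rw [hp2]
    field_simp
    ring

end Scheme

/-- **Orthogonality properties of the scheme iterates**: for all `m ∈ {0,…,N}` and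
`n ∈ {1,…,N}`, `(u^m_h, ∇_h pⁿ_h) = 0`, and for all `m ∈ {2,…,N}`,
`|u^m_h|² − |ũ^m_h|² + |u^m_h − ũ^m_h|² = 0`. -/
theorem scheme_orthogonality
    {Ω : Set E2} (hΩo : IsOpen Ω) (hΩc : IsConnected Ω) (hΩb : Bornology.IsBounded Ω)
    (M : Mesh Ω) (S : Scheme M) :
    (∀ m, m ≤ S.N → ∀ n, 1 ≤ n → n ≤ S.N →
      M.l2P0 (S.u m) (gradh (S.p n)) = 0)
    ∧ (∀ m, 2 ≤ m → m ≤ S.N →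
      (M.l2normP0 (S.u m)) ^ 2 - (M.l2normP0 (S.ut m)) ^ 2
        + (M.l2normP0 (fun t => S.u m t - S.ut m t)) ^ 2 = 0) := by
  have hA : ∀ m, m ≤ S.N → ∀ n, 1 ≤ n → n ≤ S.N →
      M.l2P0 (S.u m) (gradh (S.p n)) = 0 := fun m hm n h1 hn =>
    M.green _ _ (S.u_RT0 m hm) (S.hp n h1 hn).1
  refine ⟨hA, ?_⟩
  intro m hm hmN
  obtain ⟨n, rfl⟩ : ∃ n, m = n + 1 + 1 := ⟨m - 2, by omega⟩
  have a1 := hA _ hmN (n + 1 + 1) (by omega) hmN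
  have a2 := hA _ hmN (n + 1) (by omega) (by omega)
  have hcorr := S.corr (n + 1) (by omega) hmN
  rw [M.l2normP0_sq, M.l2normP0_sq, M.l2normP0_sq]
  have key : M.l2P0 (S.u (n + 1 + 1)) (S.u (n + 1 + 1))
      - M.l2P0 (S.ut (n + 1 + 1)) (S.ut (n + 1 + 1))
      + M.l2P0 (fun t => S.u (n + 1 + 1) t - S.ut (n + 1 + 1) t)
        (fun t => S.u (n + 1 + 1) t - S.ut (n + 1 + 1) t)
      = -2 * (2 * S.k / 3) * (M.l2P0 (S.u (n + 1 + 1)) (gradh (S.p (n + 1 + 1)))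
        - M.l2P0 (S.u (n + 1 + 1)) (gradh (S.p (n + 1)))) := by
    simp only [Mesh.l2P0]
    rw [← Finset.sum_sub_distrib, ← Finset.sum_add_distrib, ← Finset.sum_sub_distrib,
      Finset.mul_sum]
    refine Finset.sum_congr rfl fun t ht => ?_
    have h : S.ut (n + 1 + 1) t = S.u (n + 1 + 1) t
        + (2 * S.k / 3) • (gradh (S.p (n + 1 + 1)) t - gradh (S.p (n + 1)) t) := by
      rw [hcorr t ht, gradA_sub]
      simp [gradh]
    rw [h]
    generalize gradh (S.p (n + 1 + 1)) t = g
    generalize gradh (S.p (n + 1)) t = g'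
    generalize S.u (n + 1 + 1) t = x
    simp only [inner_coord, PiLp.add_apply, PiLp.sub_apply, PiLp.smul_apply, smul_eq_mul]
    ring
  rw [key, a1, a2]
  ring

end
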